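/- Let r_0, r_1, r_2, r_3 ∈ M_2(ℂ) satisfy ρ_1(r_j* r_k) = δ_{jk} and ‖r_0‖ ≤ 1. Then there exists a constant C (depending only on r_0, …, r_3 and α) such that for every ν ≥ 1, every 0 ≤ m < 4^ν, and all complex scalars α_0, …, α_{4^ν−1}, ‖Σ_{j=0}^{m} α_j h^{(ν)}_j‖_♯ ≤ C · ‖Σ_{j=0}^{4^ν−1} α_j h^{(ν)}_j‖_♯; that is, the left Haar systems h^{(ν)} are bases of (N_ν, ‖·‖_♯) with basis constants uniformly bounded in ν. -/

import Mathlib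

open Finset
open scoped ENNReal ComplexOrder Kronecker Matrix

noncomputable section

/-- Kronecker product of square complex matrices, realized on `Fin (m * n)`. -/
def kron {m n : ℕ} (x : Matrix (Fin m) (Fin m) ℂ) (y : Matrix (Fin n) (Fin n) ℂ) :
    Matrix (Fin (m * n)) (Fin (m * n)) ℂ :=
  Matrix.reindex finProdFinEquiv finProdFinEquiv (x ⊗ₖ y)

/-- The matrix `A₁ = diag(α, 1 - α)`. -/
def A1 (α : ℝ) : Matrix (Fin 2) (Fin 2) ℂ :=
  Matrix.diagonal ![(α : ℂ), ((1 - α : ℝ) : ℂ)]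

/-- The matrix `A₁^t = diag(α^t, (1 - α)^t)` (entrywise real power on the diagonal). -/
def A1t (α t : ℝ) : Matrix (Fin 2) (Fin 2) ℂ :=
  Matrix.diagonal ![((α ^ t : ℝ) : ℂ), (((1 - α) ^ t : ℝ) : ℂ)]

/-- `Amat α ν = A_ν`, the ν-fold Kronecker power of `diag(α, 1-α)`. -/
def Amat (α : ℝ) : (ν : ℕ) → Matrix (Fin (2 ^ ν)) (Fin (2 ^ ν)) ℂ
  | 0 => 1
  | ν + 1 => kron (Amat α ν) (A1 α)

/-- `Amatt α t ν = A_ν^t`, the ν-fold Kronecker power of `diag(α^t, (1-α)^t)`. -/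
def Amatt (α t : ℝ) : (ν : ℕ) → Matrix (Fin (2 ^ ν)) (Fin (2 ^ ν)) ℂ
  | 0 => 1
  | ν + 1 => kron (Amatt α t ν) (A1t α t)

/-- The state `ρ_ν(x) = Tr (x A_ν)` on `N_ν = M_{2^ν}(ℂ)`. -/
def rho (α : ℝ) (ν : ℕ) (x : Matrix (Fin (2 ^ ν)) (Fin (2 ^ ν)) ℂ) : ℂ :=
  (x * Amat α ν).trace

/-- The state `ρ_1(x) = Tr (x A_1)` on `M_2(ℂ)`. -/
def rho1 (α : ℝ) (x : Matrix (Fin 2) (Fin 2) ℂ) : ℂ :=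
  (x * A1 α).trace

/-- The Schatten `p`-norm `‖x‖_{C_p} = (Tr ((x^* x)^{p/2}))^{1/p}`, `1 ≤ p < ∞`,
computed through the eigenvalues of the positive semidefinite matrix `x^* x`. -/
def schatten {N : ℕ} (p : ℝ) (x : Matrix (Fin N) (Fin N) ℂ) : ℝ :=
  (∑ i, ((Matrix.posSemidef_conjTranspose_mul_self x).isHermitian.eigenvalues i) ^ (p / 2)) ^
    (1 / p)

/-- The operator norm `‖x‖ = ‖x‖_{C_∞}` of a complex matrix (acting on ℓ²). -/
def opNorm {N : ℕ} (x : Matrix (Fin N) (Fin N) ℂ) : ℝ :=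
  ‖Matrix.toEuclideanCLM (𝕜 := ℂ) x‖

/-- The left predual norm `‖x‖_♯ = ‖x A_ν‖_{C_1}` on `N_ν`. -/
def sharpNorm (α : ℝ) {ν : ℕ} (x : Matrix (Fin (2 ^ ν)) (Fin (2 ^ ν)) ℂ) : ℝ :=
  schatten 1 (x * Amat α ν)

/-- The right predual norm `‖x‖_♭ = ‖A_ν x‖_{C_1}` on `N_ν`. -/
def flatNorm (α : ℝ) {ν : ℕ} (x : Matrix (Fin (2 ^ ν)) (Fin (2 ^ ν)) ℂ) : ℝ :=
  schatten 1 (Amat α ν * x)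

/-- The left predual norm `‖x‖_♯ = ‖x A_1‖_{C_1}` on `M_2(ℂ)`. -/
def sharp2 (α : ℝ) (x : Matrix (Fin 2) (Fin 2) ℂ) : ℝ :=
  schatten 1 (x * A1 α)

/-- The right predual norm `‖x‖_♭ = ‖A_1 x‖_{C_1}` on `M_2(ℂ)`. -/
def flat2 (α : ℝ) (x : Matrix (Fin 2) (Fin 2) ℂ) : ℝ :=
  schatten 1 (A1 α * x)

/-- The left norm `‖x‖_{p,♯} = ‖x A_ν^{1/p}‖_{C_p}` on `N_ν`, `1 ≤ p ≤ ∞`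
(for `p = ∞` it is the operator norm). -/
def lpSharp (α : ℝ) (p : ℝ≥0∞) {ν : ℕ} (x : Matrix (Fin (2 ^ ν)) (Fin (2 ^ ν)) ℂ) : ℝ :=
  if p = ∞ then opNorm x else schatten p.toReal (x * Amatt α (1 / p.toReal) ν)

/-- The right norm `‖x‖_{p,♭} = ‖A_ν^{1/p} x‖_{C_p}` on `N_ν`, `1 ≤ p ≤ ∞`. -/
def lpFlat (α : ℝ) (p : ℝ≥0∞) {ν : ℕ} (x : Matrix (Fin (2 ^ ν)) (Fin (2 ^ ν)) ℂ) : ℝ :=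
  if p = ∞ then opNorm x else schatten p.toReal (Amatt α (1 / p.toReal) ν * x)

/-- The left norm `‖x‖_{p,♯} = ‖x A_1^{1/p}‖_{C_p}` on `M_2(ℂ)`. -/
def lp2Sharp (α : ℝ) (p : ℝ≥0∞) (x : Matrix (Fin 2) (Fin 2) ℂ) : ℝ :=
  if p = ∞ then opNorm x else schatten p.toReal (x * A1t α (1 / p.toReal))

/-- `shellNum r c` is `s(r+1, c+1) - 1`, the zero-based shell enumeration index of the
matrix unit `E_{r c}` (zero-based indices `r`, `c`): `s(r,c) = (c-1)² + r` if `r ≤ c`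
and `s(r,c) = r² - c + 1` if `r > c` (one-based). -/
def shellNum (r c : ℕ) : ℕ :=
  if r ≤ c then c * c + r else r * r + 2 * r - c

/-- `eUnit N m` is the `m`-th matrix unit `e_m` of `M_N(ℂ)` in the shell enumeration:
`e_{s(r,c) - 1} = E_{r c}`. -/
def eUnit (N m : ℕ) : Matrix (Fin N) (Fin N) ℂ :=
  Matrix.of fun r c => if shellNum (r : ℕ) (c : ℕ) = m then 1 else 0

/-- The left Haar system `h^{(ν)}_j` in `N_ν` built from `r_0, r_1, r_2, r_3 ∈ M_2(ℂ)`: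
`h^{(1)}_j = r_j`, and for `j = 4^ν q + k` (`0 ≤ q ≤ 3`, `0 ≤ k < 4^ν`),
`h^{(ν+1)}_j = h^{(ν)}_k ⊗ r_0` if `q = 0` and `h^{(ν+1)}_j = e^{(ν)}_k ⊗ r_q` if `q ≠ 0`. -/
def haar (r : ℕ → Matrix (Fin 2) (Fin 2) ℂ) :
    (ν : ℕ) → ℕ → Matrix (Fin (2 ^ ν)) (Fin (2 ^ ν)) ℂ
  | 0, _ => 1
  | 1, j => r (j % 4)
  | ν + 2, j =>
      if j / 4 ^ (ν + 1) = 0 then kron (haar r (ν + 1) j) (r 0)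
      else kron (eUnit (2 ^ (ν + 1)) (j % 4 ^ (ν + 1))) (r (j / 4 ^ (ν + 1) % 4))



/-- `u` is a contraction: `u^* u ≤ 1`. -/
def IsContr {N : ℕ} (u : Matrix (Fin N) (Fin N) ℂ) : Prop := (1 - uᴴ * u).PosSemidef

lemma isContr_mul {N : ℕ} {u v : Matrix (Fin N) (Fin N) ℂ} (hu : IsContr u) (hv : IsContr v) :
    IsContr (u * v) := by
  unfold IsContr at *
  have h := hv.add (hu.conjTranspose_mul_mul_same v)
  convert h using 1
  simp only [Matrix.conjTranspose_mul, Matrix.mul_sub, Matrix.sub_mul, Matrix.mul_one,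
    Matrix.mul_assoc]
  abel

lemma isContr_one {N : ℕ} : IsContr (1 : Matrix (Fin N) (Fin N) ℂ) := by
  unfold IsContr
  simpa using Matrix.PosSemidef.zero

lemma normSq_eq {N : ℕ} (v : Fin N → ℂ) :
    ((‖WithLp.toLp 2 v‖ ^ 2 : ℝ) : ℂ) = star v ⬝ᵥ v := by
  rw [EuclideanSpace.norm_sq_eq]
  simp only [dotProduct, Pi.star_apply, RCLike.star_def]
  push_cast
  refine Finset.sum_congr rfl fun i _ => ?_
  rw [← Complex.conj_mul']

lemma isContr_iff {N : ℕ} (u : Matrix (Fin N) (Fin N) ℂ) :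
    IsContr u ↔ ∀ v : Fin N → ℂ, ‖WithLp.toLp 2 (u *ᵥ v)‖ ≤ ‖WithLp.toLp 2 v‖ := by
  have key : ∀ v : Fin N → ℂ, star v ⬝ᵥ ((1 - uᴴ * u) *ᵥ v) =
      ((‖WithLp.toLp 2 v‖ ^ 2 - ‖WithLp.toLp 2 (u *ᵥ v)‖ ^ 2 : ℝ) : ℂ) := by
    intro v
    rw [Complex.ofReal_sub, normSq_eq, normSq_eq, Matrix.sub_mulVec, dotProduct_sub,
      Matrix.one_mulVec, Matrix.star_mulVec, ← Matrix.mulVec_mulVec, Matrix.dotProduct_mulVec]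
  unfold IsContr
  rw [Matrix.posSemidef_iff_dotProduct_mulVec]
  constructor
  · rintro ⟨-, h⟩ v
    have := h v
    rw [key, Complex.zero_le_real] at this
    exact le_of_sq_le_sq (by linarith) (norm_nonneg _)
  · intro h
    refine ⟨?_, fun v => ?_⟩
    · exact Matrix.isHermitian_one.sub (Matrix.isHermitian_conjTranspose_mul_self u)
    · rw [key, Complex.zero_le_real]
      have := pow_le_pow_left₀ (norm_nonneg _) (h v) 2
      linarith

lemma isContr_of_opNorm {N : ℕ} (u : Matrix (Fin N) (Fin N) ℂ) (h : opNorm u ≤ 1) :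
    IsContr u := by
  rw [isContr_iff]
  intro v
  rw [← Matrix.toEuclideanCLM_toLp]
  exact ContinuousLinearMap.le_of_opNorm_le _ h _ |>.trans (by simp)

lemma opNorm_conjTranspose {N : ℕ} (u : Matrix (Fin N) (Fin N) ℂ) :
    opNorm uᴴ = opNorm u := by
  unfold opNorm
  rw [← Matrix.star_eq_conjTranspose, map_star, ContinuousLinearMap.star_eq_adjoint]
  exact LinearIsometryEquiv.norm_map _ _

lemma exists_contr {N : ℕ} (u : Matrix (Fin N) (Fin N) ℂ) :
    ∃ c : ℝ, 0 ≤ c ∧ ∃ k, IsContr k ∧ u = (c : ℂ) • k := by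
  have h0 : 0 ≤ opNorm u := norm_nonneg _
  have h1 : (opNorm u + 1 : ℝ) ≠ 0 := by positivity
  refine ⟨opNorm u + 1, by positivity, ((opNorm u + 1 : ℝ) : ℂ)⁻¹ • u, ?_, ?_⟩
  · apply isContr_of_opNorm
    unfold opNorm at *
    rw [map_smul, norm_smul, norm_inv, Complex.norm_real, Real.norm_of_nonneg (by positivity)]
    rw [inv_mul_le_one₀ (by positivity)]
    linarith
  · rw [smul_smul, mul_inv_cancel₀ (by exact_mod_cast h1), one_smul]

lemma contr_trace_le {N : ℕ} {w p : Matrix (Fin N) (Fin N) ℂ} (hw : IsContr w)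
    (hp : p.PosSemidef) : ‖(w * p).trace‖ ≤ p.trace.re := by
  obtain ⟨m, v, rfl⟩ := Matrix.posSemidef_iff_eq_sum_vecMulVec.mp hp
  rw [Matrix.mul_sum, Matrix.trace_sum, Matrix.trace_sum, Complex.re_sum]
  refine (norm_sum_le _ _).trans (Finset.sum_le_sum fun i _ => ?_)
  rw [Matrix.mul_vecMulVec, Matrix.trace_vecMulVec, Matrix.trace_vecMulVec, dotProduct_comm (v i),
    ← normSq_eq, Complex.ofReal_re]
  have : (w *ᵥ v i) ⬝ᵥ star (v i) = inner ℂ (WithLp.toLp 2 (v i)) (WithLp.toLp 2 (w *ᵥ v i)) := by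
    rw [EuclideanSpace.inner_eq_star_dotProduct]
  rw [this, pow_two]
  refine (norm_inner_le_norm _ _).trans ?_
  exact mul_le_mul_of_nonneg_left ((isContr_iff w).1 hw _) (norm_nonneg _)

lemma schatten_one {N : ℕ} (x : Matrix (Fin N) (Fin N) ℂ) :
    schatten 1 x =
      ∑ i, √((Matrix.posSemidef_conjTranspose_mul_self x).isHermitian.eigenvalues i) := by
  unfold schatten
  simp [Real.sqrt_eq_rpow]

lemma polar {N : ℕ} (x : Matrix (Fin N) (Fin N) ℂ) :
    ∃ u p : Matrix (Fin N) (Fin N) ℂ, IsContr u ∧ IsContr uᴴ ∧ p.PosSemidef ∧ x = u * p ∧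
      uᴴ * x = p ∧ p.trace = schatten 1 x := by
  set hP := Matrix.posSemidef_conjTranspose_mul_self x
  set l := hP.isHermitian.eigenvalues with hl
  have hl0 : ∀ i, 0 ≤ l i := hP.eigenvalues_nonneg
  set V : Matrix (Fin N) (Fin N) ℂ := hP.isHermitian.eigenvectorUnitary.1 with hV
  have hVV : Vᴴ * V = 1 := Matrix.mem_unitaryGroup_iff'.1 hP.isHermitian.eigenvectorUnitary.2
  have hVV' : V * Vᴴ = 1 := Matrix.mem_unitaryGroup_iff.1 hP.isHermitian.eigenvectorUnitary.2
  have hspec : xᴴ * x = V * Matrix.diagonal (fun i => ((l i : ℝ) : ℂ)) * Vᴴ := by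
    have := hP.isHermitian.spectral_theorem
    rw [Unitary.conjStarAlgAut_apply] at this
    exact this
  set D : (Fin N → ℝ) → Matrix (Fin N) (Fin N) ℂ := fun f => Matrix.diagonal fun i => (f i : ℂ)
    with hD
  have hDm : ∀ f g, D f * D g = D (fun i => f i * g i) := by
    intro f g; simp [hD, Matrix.diagonal_mul_diagonal]
  have hDh : ∀ f, (D f)ᴴ = D f := by
    intro f
    simp only [hD, Matrix.diagonal_conjTranspose]
    congr 1; ext i; simp
  set F : (Fin N → ℝ) → Matrix (Fin N) (Fin N) ℂ := fun f => V * D f * Vᴴ with hF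
  have hFm : ∀ f g, F f * F g = F (fun i => f i * g i) := by
    intro f g
    simp only [hF, ← hDm]
    calc V * D f * Vᴴ * (V * D g * Vᴴ) = V * D f * (Vᴴ * V) * D g * Vᴴ := by
          simp only [Matrix.mul_assoc]
      _ = _ := by rw [hVV]; simp only [Matrix.mul_assoc, Matrix.mul_one]
  have hFh : ∀ f, (F f)ᴴ = F f := by
    intro f
    simp only [hF, Matrix.conjTranspose_mul, Matrix.conjTranspose_conjTranspose, hDh,
      Matrix.mul_assoc]
  have hF1 : F (fun _ => 1) = 1 := by simp [hF, hD, hVV']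
  have hFs : ∀ f g, F f - F g = F (fun i => f i - g i) := by
    intro f g
    simp only [hF, ← Matrix.sub_mul, ← Matrix.mul_sub]
    congr 2
    simp [hD, Matrix.diagonal_sub]
  have hFp : ∀ f, (∀ i, 0 ≤ f i) → (F f).PosSemidef := by
    intro f hf
    apply Matrix.PosSemidef.mul_mul_conjTranspose_same
    apply Matrix.PosSemidef.diagonal
    intro i
    simpa using hf i
  have hxx : xᴴ * x = F l := hspec
  clear_value F D V
  set e : Fin N → ℝ := fun i => if l i = 0 then 0 else 1 with he
  have hxe : x * F e = x := by
    have h : (x * F (fun i => 1 - e i))ᴴ * (x * F (fun i => 1 - e i)) = 0 := by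
      rw [Matrix.conjTranspose_mul, hFh]
      calc _ = F (fun i => 1 - e i) * (xᴴ * x) * F (fun i => 1 - e i) := by
            simp only [Matrix.mul_assoc]
        _ = F (fun i => 0) := by
            rw [hxx, hFm, hFm]; congr 1; ext i; simp only [he]; split_ifs with h <;> simp [h]
        _ = 0 := by
            have := hFs e e
            simpa using this.symm
    rw [Matrix.conjTranspose_mul_self_eq_zero, ← hFs, hF1, Matrix.mul_sub, Matrix.mul_one,
      sub_eq_zero] at h
    exact h.symm
  set u := x * F (fun i => (√(l i))⁻¹) with hu
  have huu : uᴴ * u = F e := by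
    rw [hu, Matrix.conjTranspose_mul, hFh]
    calc _ = F (fun i => (√(l i))⁻¹) * (xᴴ * x) * F (fun i => (√(l i))⁻¹) := by
            simp only [Matrix.mul_assoc]
      _ = F e := by
        rw [hxx, hFm, hFm]; congr 1; ext i; simp only [he]; split_ifs with h
        · simp [h]
        · have h1 : √(l i) ≠ 0 := by
            rw [Real.sqrt_ne_zero (hl0 i)]; exact h
          have h2 := Real.mul_self_sqrt (hl0 i)
          field_simp
          nlinarith
  have hue : u * F e = u := by
    rw [hu, Matrix.mul_assoc, hFm]
    congr 2; ext i; simp only [he]; split_ifs with h <;> simp [h]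
  refine ⟨u, F (fun i => √(l i)), ?_, ?_, hFp _ fun i => Real.sqrt_nonneg _, ?_, ?_, ?_⟩
  · unfold IsContr
    rw [huu, ← hF1, hFs]
    apply hFp
    intro i; simp only [he]; split_ifs <;> simp
  · unfold IsContr
    rw [Matrix.conjTranspose_conjTranspose]
    have : (1 - u * uᴴ) = (1 - u * uᴴ)ᴴ * (1 - u * uᴴ) := by
      have h4 : u * uᴴ * (u * uᴴ) = u * uᴴ := by
        calc _ = u * (uᴴ * u) * uᴴ := by simp only [Matrix.mul_assoc]
          _ = _ := by rw [huu, hue]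
      simp only [Matrix.conjTranspose_sub, Matrix.conjTranspose_one, Matrix.conjTranspose_mul,
        Matrix.conjTranspose_conjTranspose, Matrix.sub_mul, Matrix.mul_sub, Matrix.one_mul,
        Matrix.mul_one, h4]
      abel
    rw [this]
    exact Matrix.posSemidef_conjTranspose_mul_self _
  · rw [hu, Matrix.mul_assoc, hFm]
    conv_lhs => rw [← hxe]
    congr 2; ext i; simp only [he]; split_ifs with h
    · simp [h]
    · have h1 : √(l i) ≠ 0 := by
        rw [Real.sqrt_ne_zero (hl0 i)]; exact h
      field_simp
  · rw [hu, Matrix.conjTranspose_mul, hFh, Matrix.mul_assoc, hxx, hFm]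
    congr 1; ext i
    rcases eq_or_ne (l i) 0 with h | h
    · simp [h]
    · have h1 : √(l i) ≠ 0 := by
        rw [Real.sqrt_ne_zero (hl0 i)]; exact h
      have h2 := Real.mul_self_sqrt (hl0 i)
      field_simp
      nlinarith
  · rw [schatten_one, hF, Matrix.trace_mul_comm, ← Matrix.mul_assoc, hVV, Matrix.one_mul, hD,
      Matrix.trace_diagonal]
    push_cast
    rfl

lemma schatten_nonneg {N : ℕ} (x : Matrix (Fin N) (Fin N) ℂ) : 0 ≤ schatten 1 x := by
  rw [schatten_one]
  exact Finset.sum_nonneg fun i _ => Real.sqrt_nonneg _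

lemma trace_le_schatten {N : ℕ} {w : Matrix (Fin N) (Fin N) ℂ} (hw : IsContr w)
    (x : Matrix (Fin N) (Fin N) ℂ) : ‖(w * x).trace‖ ≤ schatten 1 x := by
  obtain ⟨u, p, hu, -, hp, hx, -, ht⟩ := polar x
  have := contr_trace_le (isContr_mul hw hu) hp
  rw [ht, Complex.ofReal_re, Matrix.mul_assoc, ← hx] at this
  exact this

lemma schatten_le {N : ℕ} (x : Matrix (Fin N) (Fin N) ℂ) (c : ℝ)
    (h : ∀ w, IsContr w → ‖(w * x).trace‖ ≤ c) : schatten 1 x ≤ c := by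
  obtain ⟨u, p, -, hu, hp, -, hx, ht⟩ := polar x
  have := h _ hu
  rw [hx, ht, Complex.norm_real, Real.norm_of_nonneg (schatten_nonneg x)] at this
  exact this

lemma schatten_contr_mul_psd {N : ℕ} {u p : Matrix (Fin N) (Fin N) ℂ} (hu : IsContr u)
    (hp : p.PosSemidef) : schatten 1 (u * p) ≤ p.trace.re := by
  refine schatten_le _ _ fun w hw => ?_
  rw [← Matrix.mul_assoc]
  exact contr_trace_le (isContr_mul hw hu) hp

lemma schatten_add {N : ℕ} (x y : Matrix (Fin N) (Fin N) ℂ) :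
    schatten 1 (x + y) ≤ schatten 1 x + schatten 1 y := by
  refine schatten_le _ _ fun w hw => ?_
  rw [Matrix.mul_add, Matrix.trace_add]
  exact (norm_add_le _ _).trans (add_le_add (trace_le_schatten hw x) (trace_le_schatten hw y))

lemma schatten_smul {N : ℕ} (c : ℂ) (x : Matrix (Fin N) (Fin N) ℂ) :
    schatten 1 (c • x) ≤ ‖c‖ * schatten 1 x := by
  refine schatten_le _ _ fun w hw => ?_
  rw [Matrix.mul_smul, Matrix.trace_smul, norm_smul]
  exact mul_le_mul_of_nonneg_left (trace_le_schatten hw x) (norm_nonneg _)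

lemma schatten_sub {N : ℕ} (x y : Matrix (Fin N) (Fin N) ℂ) :
    schatten 1 (x - y) ≤ schatten 1 x + schatten 1 y := by
  refine schatten_le _ _ fun w hw => ?_
  rw [Matrix.mul_sub, Matrix.trace_sub]
  exact (norm_sub_le _ _).trans (add_le_add (trace_le_schatten hw x) (trace_le_schatten hw y))

lemma schatten_zero {N : ℕ} : schatten 1 (0 : Matrix (Fin N) (Fin N) ℂ) = 0 := by
  refine le_antisymm (schatten_le _ _ fun w hw => by simp) (schatten_nonneg _)

lemma schatten_mul_left {N : ℕ} {u : Matrix (Fin N) (Fin N) ℂ} (hu : IsContr u)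
    (x : Matrix (Fin N) (Fin N) ℂ) : schatten 1 (u * x) ≤ schatten 1 x := by
  refine schatten_le _ _ fun w hw => ?_
  rw [← Matrix.mul_assoc]
  exact trace_le_schatten (isContr_mul hw hu) x

lemma schatten_mul_right {N : ℕ} {u : Matrix (Fin N) (Fin N) ℂ} (hu : IsContr u)
    (x : Matrix (Fin N) (Fin N) ℂ) : schatten 1 (x * u) ≤ schatten 1 x := by
  refine schatten_le _ _ fun w hw => ?_
  rw [← Matrix.mul_assoc, Matrix.trace_mul_comm, ← Matrix.mul_assoc]
  exact trace_le_schatten (isContr_mul hu hw) x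

lemma kron_mul {m n : ℕ} (a c : Matrix (Fin m) (Fin m) ℂ) (b d : Matrix (Fin n) (Fin n) ℂ) :
    kron a b * kron c d = kron (a * c) (b * d) := by
  simp only [kron, Matrix.reindex_apply, Matrix.submatrix_mul_equiv, Matrix.mul_kronecker_mul]

lemma kron_apply {m n : ℕ} (a : Matrix (Fin m) (Fin m) ℂ) (b : Matrix (Fin n) (Fin n) ℂ)
    (i j : Fin m) (k l : Fin n) :
    kron a b (finProdFinEquiv (i, k)) (finProdFinEquiv (j, l)) = a i j * b k l := by
  simp [kron]

lemma kron_sum_left {m n : ℕ} {ι : Type*} (s : Finset ι) (a : ι → Matrix (Fin m) (Fin m) ℂ)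
    (b : Matrix (Fin n) (Fin n) ℂ) : kron (∑ i ∈ s, a i) b = ∑ i ∈ s, kron (a i) b := by
  ext i j
  obtain ⟨⟨i, k⟩, rfl⟩ := finProdFinEquiv.surjective i
  obtain ⟨⟨j, l⟩, rfl⟩ := finProdFinEquiv.surjective j
  simp only [Matrix.sum_apply, kron_apply, Finset.sum_mul]

lemma kron_smul_left {m n : ℕ} (c : ℂ) (a : Matrix (Fin m) (Fin m) ℂ)
    (b : Matrix (Fin n) (Fin n) ℂ) : kron (c • a) b = c • kron a b := by
  ext i j
  obtain ⟨⟨i, k⟩, rfl⟩ := finProdFinEquiv.surjective i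
  obtain ⟨⟨j, l⟩, rfl⟩ := finProdFinEquiv.surjective j
  simp only [Matrix.smul_apply, kron_apply, smul_eq_mul, mul_assoc]

lemma kron_conjTranspose {m n : ℕ} (a : Matrix (Fin m) (Fin m) ℂ)
    (b : Matrix (Fin n) (Fin n) ℂ) : (kron a b)ᴴ = kron aᴴ bᴴ := by
  ext i j
  obtain ⟨⟨i, k⟩, rfl⟩ := finProdFinEquiv.surjective i
  obtain ⟨⟨j, l⟩, rfl⟩ := finProdFinEquiv.surjective j
  simp only [Matrix.conjTranspose_apply, kron_apply, star_mul']

lemma kron_one_one {m n : ℕ} : kron (1 : Matrix (Fin m) (Fin m) ℂ) (1 : Matrix (Fin n) (Fin n) ℂ)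
    = 1 := by
  simp [kron]

lemma kron_sub_left {m n : ℕ} (a c : Matrix (Fin m) (Fin m) ℂ)
    (b : Matrix (Fin n) (Fin n) ℂ) : kron (a - c) b = kron a b - kron c b := by
  ext i j
  obtain ⟨⟨i, k⟩, rfl⟩ := finProdFinEquiv.surjective i
  obtain ⟨⟨j, l⟩, rfl⟩ := finProdFinEquiv.surjective j
  simp only [Matrix.sub_apply, kron_apply, sub_mul]

lemma kron_sub_right {m n : ℕ} (a : Matrix (Fin m) (Fin m) ℂ)
    (b c : Matrix (Fin n) (Fin n) ℂ) : kron a (b - c) = kron a b - kron a c := by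
  ext i j
  obtain ⟨⟨i, k⟩, rfl⟩ := finProdFinEquiv.surjective i
  obtain ⟨⟨j, l⟩, rfl⟩ := finProdFinEquiv.surjective j
  simp only [Matrix.sub_apply, kron_apply, mul_sub]

lemma kron_posSemidef {m n : ℕ} {a : Matrix (Fin m) (Fin m) ℂ}
    {b : Matrix (Fin n) (Fin n) ℂ} (ha : a.PosSemidef) (hb : b.PosSemidef) :
    (kron a b).PosSemidef := (ha.kronecker hb).submatrix _

lemma kron_trace {m n : ℕ} (a : Matrix (Fin m) (Fin m) ℂ)
    (b : Matrix (Fin n) (Fin n) ℂ) : (kron a b).trace = a.trace * b.trace := by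
  rw [← Matrix.trace_kronecker]
  simp only [Matrix.trace, kron, ← finProdFinEquiv.sum_comp, Matrix.diag]
  simp

lemma isContr_kron_one {m n : ℕ} {a : Matrix (Fin m) (Fin m) ℂ} (ha : IsContr a) :
    IsContr (kron a (1 : Matrix (Fin n) (Fin n) ℂ)) := by
  unfold IsContr at *
  have := kron_posSemidef ha (Matrix.PosSemidef.one (n := Fin n) (R := ℂ))
  rw [kron_sub_left, kron_one_one] at this
  rw [kron_conjTranspose, kron_mul]
  simpa using this

lemma isContr_one_kron {m n : ℕ} {a : Matrix (Fin n) (Fin n) ℂ} (ha : IsContr a) :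
    IsContr (kron (1 : Matrix (Fin m) (Fin m) ℂ) a) := by
  unfold IsContr at *
  have := kron_posSemidef (Matrix.PosSemidef.one (n := Fin m) (R := ℂ)) ha
  rw [kron_sub_right, kron_one_one] at this
  rw [kron_conjTranspose, kron_mul]
  simpa using this

lemma schatten_kron {m n : ℕ} (x : Matrix (Fin m) (Fin m) ℂ) (y : Matrix (Fin n) (Fin n) ℂ) :
    schatten 1 (kron x y) ≤ schatten 1 x * schatten 1 y := by
  obtain ⟨u, p, hu, -, hp, hx, -, hpt⟩ := polar x
  obtain ⟨v, q, hv, -, hq, hy, -, hqt⟩ := polar y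
  have h := schatten_contr_mul_psd (isContr_mul (isContr_kron_one (n := n) hu)
    (isContr_one_kron (m := m) hv)) (kron_posSemidef hp hq)
  rw [kron_mul, kron_mul, kron_trace, hpt, hqt, Matrix.mul_one, Matrix.one_mul, ← hx, ← hy,
    ← Complex.ofReal_mul, Complex.ofReal_re] at h
  exact h

/-- Partial trace over the second tensor factor. -/
def ptr {m n : ℕ} (z : Matrix (Fin (m * n)) (Fin (m * n)) ℂ) : Matrix (Fin m) (Fin m) ℂ :=
  Matrix.of fun i j => ∑ k : Fin n, z (finProdFinEquiv (i, k)) (finProdFinEquiv (j, k))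

lemma ptr_kron {m n : ℕ} (a : Matrix (Fin m) (Fin m) ℂ) (b : Matrix (Fin n) (Fin n) ℂ) :
    ptr (kron a b) = b.trace • a := by
  ext i j
  simp only [ptr, Matrix.of_apply, kron_apply, Matrix.smul_apply, smul_eq_mul, ← Finset.mul_sum,
    Matrix.trace, Matrix.diag]
  ring

lemma ptr_sum {m n : ℕ} {ι : Type*} (s : Finset ι)
    (z : ι → Matrix (Fin (m * n)) (Fin (m * n)) ℂ) : ptr (∑ i ∈ s, z i) = ∑ i ∈ s, ptr (z i) := by
  ext i j
  simp only [ptr, Matrix.of_apply, Matrix.sum_apply]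
  rw [Finset.sum_comm]

lemma trace_mul_ptr {m n : ℕ} (w : Matrix (Fin m) (Fin m) ℂ)
    (z : Matrix (Fin (m * n)) (Fin (m * n)) ℂ) :
    (w * ptr z).trace = (kron w (1 : Matrix (Fin n) (Fin n) ℂ) * z).trace := by
  simp only [Matrix.trace, Matrix.diag, Matrix.mul_apply, ← finProdFinEquiv.sum_comp,
    Fintype.sum_prod_type, kron_apply, ptr, Matrix.of_apply, Matrix.one_apply, mul_ite, mul_one,
    mul_zero, ite_mul, zero_mul, Finset.sum_ite_eq, Finset.mem_univ, if_true, Finset.mul_sum]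
  refine Finset.sum_congr rfl fun i _ => ?_
  rw [Finset.sum_comm]

lemma schatten_ptr {m n : ℕ} (z : Matrix (Fin (m * n)) (Fin (m * n)) ℂ) :
    schatten 1 (ptr z) ≤ schatten 1 z := by
  refine schatten_le _ _ fun w hw => ?_
  rw [trace_mul_ptr]
  exact trace_le_schatten (isContr_kron_one hw) z

open Classical in
/-- Indicator projection. -/
def indP {N : ℕ} (P : ℕ → Prop) : Matrix (Fin N) (Fin N) ℂ :=
  Matrix.diagonal fun i => if P i then 1 else 0

lemma indP_contr {N : ℕ} (P : ℕ → Prop) : IsContr (indP (N := N) P) := by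
  unfold IsContr indP
  rw [Matrix.diagonal_conjTranspose, Matrix.diagonal_mul_diagonal, ← Matrix.diagonal_one,
    Matrix.diagonal_sub]
  apply Matrix.PosSemidef.diagonal
  intro i
  by_cases h : P i <;> simp [h]

open Classical in
lemma indP_mul_mul {N : ℕ} (P Q : ℕ → Prop) (y : Matrix (Fin N) (Fin N) ℂ) (i j : Fin N) :
    (indP (N := N) P * y * indP (N := N) Q : Matrix (Fin N) (Fin N) ℂ) i j = if P i ∧ Q j then y i j else 0 := by
  unfold indP
  rw [Matrix.mul_diagonal, Matrix.diagonal_mul]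
  by_cases h : P i <;> by_cases h' : Q j <;> simp [h, h']

lemma schatten_ind {N : ℕ} (P Q : ℕ → Prop) (y : Matrix (Fin N) (Fin N) ℂ) :
    schatten 1 (indP P * y * indP Q) ≤ schatten 1 y :=
  (schatten_mul_right (indP_contr Q) _).trans (schatten_mul_left (indP_contr P) _)

/-- Shell truncation. -/
def mask {N : ℕ} (k : ℕ) (y : Matrix (Fin N) (Fin N) ℂ) : Matrix (Fin N) (Fin N) ℂ :=
  Matrix.of fun r c => if shellNum (r : ℕ) (c : ℕ) < k then y r c else 0

lemma shell_low (n t r c : ℕ) (ht : t ≤ n) :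
    shellNum r c < n * n + t ↔ (r < n ∧ c < n) ∨ (r < t ∧ c = n) := by
  unfold shellNum
  split_ifs with h
  · rcases lt_trichotomy c n with hc | hc | hc
    · have : c * c + c + c + 1 ≤ n * n := by nlinarith
      constructor
      · intro _; left; omega
      · intro _; omega
    · subst hc
      constructor
      · intro _; right; omega
      · intro _; omega
    · have : n * n + n + n + 1 ≤ c * c := by nlinarith
      constructor
      · intro _; omega
      · intro _; omega
  · rcases lt_or_ge r n with hc | hc
    · have : r * r + r + r + 1 ≤ n * n := by nlinarith
      constructor
      · intro _; left; omega
      · intro _; omega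
    · have : n * n ≤ r * r := by nlinarith
      constructor
      · intro _; omega
      · intro _; omega

lemma shell_high (n t r c : ℕ) (ht : n < t) (ht' : t ≤ 2 * n) :
    shellNum r c < n * n + t ↔ (r ≤ n ∧ c ≤ n) ∧ ¬ (r = n ∧ c ≤ 2 * n - t) := by
  unfold shellNum
  split_ifs with h
  · rcases lt_or_ge n c with hc | hc
    · have : n * n + n + n + 1 ≤ c * c := by nlinarith
      constructor
      · intro _; omega
      · intro _; omega
    · have : c * c ≤ n * n := by nlinarith
      constructor
      · intro _; omega
      · intro _; omega
  · rcases lt_trichotomy r n with hc | hc | hc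
    · have : r * r + r + r + 1 ≤ n * n := by nlinarith
      constructor
      · intro _; omega
      · intro _; omega
    · subst hc
      constructor
      · intro _; omega
      · intro _; omega
    · have : n * n + n + n + 1 ≤ r * r := by nlinarith
      constructor
      · intro _; omega
      · intro _; omega

lemma shell_lt (N r c : ℕ) (hr : r < N) (hc : c < N) : shellNum r c < N * N := by
  have := (shell_low N 0 r c (Nat.zero_le _)).2 (Or.inl ⟨hr, hc⟩)
  simpa using this

lemma schatten_mask {N : ℕ} (k : ℕ) (y : Matrix (Fin N) (Fin N) ℂ) :
    schatten 1 (mask k y) ≤ 2 * schatten 1 y := by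
  obtain ⟨n, t, ht, rfl⟩ : ∃ n t, t ≤ 2 * n ∧ k = n * n + t := by
    refine ⟨Nat.sqrt k, k - Nat.sqrt k * Nat.sqrt k, ?_, ?_⟩
    · have := Nat.sqrt_le_add k; omega
    · have := Nat.sqrt_le k; omega
  rcases le_or_gt t n with h | h
  · have : mask (n * n + t) y = indP (· < n) * y * indP (· < n) + indP (· < t) * y * indP (· = n) := by
      ext i j
      rw [Matrix.add_apply, indP_mul_mul, indP_mul_mul]
      simp only [mask, Matrix.of_apply, shell_low n t _ _ h]
      by_cases h1 : (i : ℕ) < n ∧ (j : ℕ) < n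
      · have h2 : ¬ ((i : ℕ) < t ∧ (j : ℕ) = n) := by omega
        simp [h1, h2]
      · simp [h1]
    rw [this]
    refine (schatten_add _ _).trans ?_
    linarith [schatten_ind (· < n) (· < n) y, schatten_ind (· < t) (· = n) y]
  · have : mask (n * n + t) y =
        indP (· ≤ n) * y * indP (· ≤ n) - indP (· = n) * y * indP (· ≤ 2 * n - t) := by
      ext i j
      rw [Matrix.sub_apply, indP_mul_mul, indP_mul_mul]
      simp only [mask, Matrix.of_apply, shell_high n t _ _ h ht]
      by_cases h1 : (i : ℕ) = n ∧ (j : ℕ) ≤ 2 * n - t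
      · have h2 : (i : ℕ) ≤ n ∧ (j : ℕ) ≤ n := by omega
        simp [h1, h2]
      · simp only [h1, not_false_eq_true, and_true, if_false, sub_zero]
        congr
    rw [this]
    refine (schatten_sub _ _).trans ?_
    linarith [schatten_ind (· ≤ n) (· ≤ n) y, schatten_ind (· = n) (· ≤ 2 * n - t) y]

lemma mask_mul_diagonal {N : ℕ} (k : ℕ) (y : Matrix (Fin N) (Fin N) ℂ) (d : Fin N → ℂ) :
    mask k y * Matrix.diagonal d = mask k (y * Matrix.diagonal d) := by
  ext i j
  simp only [mask, Matrix.mul_diagonal, Matrix.of_apply, ite_mul, zero_mul]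

lemma sum_eUnit_apply {N : ℕ} (k : ℕ) (b : ℕ → ℂ) (i j : Fin N) :
    (∑ l ∈ Finset.range k, b l • eUnit N l) i j =
      if shellNum (i : ℕ) (j : ℕ) < k then b (shellNum i j) else 0 := by
  rw [Matrix.sum_apply]
  simp [eUnit, Matrix.smul_apply]

lemma sum_eUnit_mask {N : ℕ} (k : ℕ) (b : ℕ → ℂ) :
    ∑ l ∈ Finset.range k, b l • eUnit N l =
      mask k (∑ l ∈ Finset.range (N * N), b l • eUnit N l) := by
  ext i j
  simp only [mask, Matrix.of_apply, sum_eUnit_apply, shell_lt N i j i.2 j.2, if_true]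

lemma Amat_diagonal (α : ℝ) (ν : ℕ) : ∃ d, Amat α ν = Matrix.diagonal d := by
  induction ν with
  | zero => exact ⟨fun _ => 1, by simp [Amat]⟩
  | succ ν ih =>
    obtain ⟨d, hd⟩ := ih
    rw [Amat, hd]
    refine ⟨fun i => d (finProdFinEquiv.symm i).1 *
      ![(α : ℂ), ((1 - α : ℝ) : ℂ)] (finProdFinEquiv.symm i).2, ?_⟩
    unfold kron A1
    rw [Matrix.diagonal_kronecker_diagonal, Matrix.reindex_apply, Matrix.submatrix_diagonal_equiv]
    rfl

/-- `kron` with the index type in the form `2 ^ (ν + 1)`. -/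
def kr {ν : ℕ} (x : Matrix (Fin (2 ^ ν)) (Fin (2 ^ ν)) ℂ) (y : Matrix (Fin 2) (Fin 2) ℂ) :
    Matrix (Fin (2 ^ (ν + 1))) (Fin (2 ^ (ν + 1))) ℂ := kron x y

lemma kr_sum_left {ν : ℕ} {ι : Type*} (s : Finset ι)
    (a : ι → Matrix (Fin (2 ^ ν)) (Fin (2 ^ ν)) ℂ) (b : Matrix (Fin 2) (Fin 2) ℂ) :
    kr (∑ i ∈ s, a i) b = ∑ i ∈ s, kr (a i) b := kron_sum_left s a b

lemma kr_smul_left {ν : ℕ} (c : ℂ) (a : Matrix (Fin (2 ^ ν)) (Fin (2 ^ ν)) ℂ)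
    (b : Matrix (Fin 2) (Fin 2) ℂ) : kr (c • a) b = c • kr a b := kron_smul_left c a b

lemma haar_block (r : ℕ → Matrix (Fin 2) (Fin 2) ℂ) (ν q k : ℕ) (hq : q < 4) (hk : k < 4 ^ ν) :
    haar r (ν + 1) (4 ^ ν * q + k) =
      if q = 0 then kr (haar r ν k) (r 0) else kr (eUnit (2 ^ ν) k) (r q) := by
  have hdiv : (4 ^ ν * q + k) / 4 ^ ν = q := by
    rw [Nat.mul_add_div (by positivity), Nat.div_eq_of_lt hk, add_zero]
  have hmod : (4 ^ ν * q + k) % 4 ^ ν = k := by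
    rw [Nat.mul_add_mod, Nat.mod_eq_of_lt hk]
  have hq4 : q % 4 = q := Nat.mod_eq_of_lt hq
  cases ν with
  | zero =>
    have hk0 : k = 0 := by simpa using hk
    subst hk0
    have key : ∀ z : Matrix (Fin 2) (Fin 2) ℂ,
        (kron (1 : Matrix (Fin (2 ^ 0)) (Fin (2 ^ 0)) ℂ) z :
          Matrix (Fin (2 ^ 0 * 2)) (Fin (2 ^ 0 * 2)) ℂ) = z := by
      intro z
      ext i j
      fin_cases i <;> fin_cases j <;>
        simp [kron, finProdFinEquiv, Fin.divNat, Fin.modNat]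
    have he : eUnit (2 ^ 0) 0 = 1 := by
      ext i j
      have hi : i = 0 := Subsingleton.elim (α := Fin 1) _ _
      have hj : j = 0 := Subsingleton.elim (α := Fin 1) _ _
      subst hi hj
      simp [eUnit, shellNum]
    have h0 : haar r 0 0 = 1 := rfl
    have h1 : haar r (0 + 1) (4 ^ 0 * q + 0) = r q := by
      show r ((4 ^ 0 * q + 0) % 4) = r q
      simp [hq4]
    rw [h1, h0, he]
    split_ifs with h
    · subst h; exact (key _).symm
    · exact (key _).symm
  | succ ν =>
    rw [haar, hdiv, hmod, hq4]
    rcases eq_or_ne q 0 with h | h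
    · subst h; simp only [if_true, mul_zero, zero_add]; rfl
    · rw [if_neg h]; exact (if_neg h).trans rfl

/-- Partial sums of the Haar expansion. -/
def hsum (r : ℕ → Matrix (Fin 2) (Fin 2) ℂ) (a : ℕ → ℂ) (ν m : ℕ) :
    Matrix (Fin (2 ^ ν)) (Fin (2 ^ ν)) ℂ := ∑ j ∈ Finset.range m, a j • haar r ν j

/-- Partial sums of the blocks of the Haar expansion. -/
def blk (r : ℕ → Matrix (Fin 2) (Fin 2) ℂ) (a : ℕ → ℂ) (ν q k : ℕ) :
    Matrix (Fin (2 ^ ν)) (Fin (2 ^ ν)) ℂ :=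
  if q = 0 then hsum r a ν k
  else ∑ l ∈ Finset.range k, a (4 ^ ν * q + l) • eUnit (2 ^ ν) l

lemma blk_kr (r : ℕ → Matrix (Fin 2) (Fin 2) ℂ) (a : ℕ → ℂ) (ν q k : ℕ) (hq : q < 4)
    (hk : k ≤ 4 ^ ν) :
    ∑ l ∈ Finset.range k, a (4 ^ ν * q + l) • haar r (ν + 1) (4 ^ ν * q + l) =
      kr (blk r a ν q k) (r q) := by
  have h1 : ∑ l ∈ Finset.range k, a (4 ^ ν * q + l) • haar r (ν + 1) (4 ^ ν * q + l) =
      ∑ l ∈ Finset.range k, a (4 ^ ν * q + l) •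
        if q = 0 then kr (haar r ν l) (r 0) else kr (eUnit (2 ^ ν) l) (r q) := by
    refine Finset.sum_congr rfl fun l hl => ?_
    rw [haar_block r ν q l hq (lt_of_lt_of_le (Finset.mem_range.1 hl) hk)]
  rw [h1]
  unfold blk hsum
  by_cases h : q = 0
  · subst h
    simp only [if_true, kr_sum_left, kr_smul_left, mul_zero, zero_add]
  · simp only [h, if_false, kr_sum_left, kr_smul_left]

lemma hsum_succ (r : ℕ → Matrix (Fin 2) (Fin 2) ℂ) (a : ℕ → ℂ) (ν q k : ℕ) (hq : q < 4)
    (hk : k ≤ 4 ^ ν) :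
    hsum r a (ν + 1) (4 ^ ν * q + k) =
      ∑ p ∈ Finset.range q, kr (blk r a ν p (4 ^ ν)) (r p) + kr (blk r a ν q k) (r q) := by
  have step : ∀ q k, q < 4 → k ≤ 4 ^ ν → hsum r a (ν + 1) (4 ^ ν * q + k) =
      hsum r a (ν + 1) (4 ^ ν * q) + kr (blk r a ν q k) (r q) := by
    intro q k hq hk
    rw [← blk_kr r a ν q k hq hk]
    unfold hsum
    exact Finset.sum_range_add _ _ _
  have full : ∀ q, q < 4 → hsum r a (ν + 1) (4 ^ ν * q) =
      ∑ p ∈ Finset.range q, kr (blk r a ν p (4 ^ ν)) (r p) := by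
    intro q
    induction q with
    | zero => intro _; simp [hsum]
    | succ q ih =>
      intro h
      rw [Nat.mul_succ, step q _ (by omega) le_rfl, ih (by omega), Finset.sum_range_succ]
  rw [step q k hq hk, full q hq]

lemma hsum_full (r : ℕ → Matrix (Fin 2) (Fin 2) ℂ) (a : ℕ → ℂ) (ν : ℕ) :
    hsum r a (ν + 1) (4 ^ (ν + 1)) =
      ∑ p ∈ Finset.range 4, kr (blk r a ν p (4 ^ ν)) (r p) := by
  have := hsum_succ r a ν 3 (4 ^ ν) (by norm_num) le_rfl
  rw [Finset.sum_range_succ, ← this]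
  congr 1

lemma sharp_kr (α : ℝ) (ν : ℕ) (x : Matrix (Fin (2 ^ ν)) (Fin (2 ^ ν)) ℂ)
    (y : Matrix (Fin 2) (Fin 2) ℂ) :
    sharpNorm α (kr x y) ≤ sharpNorm α x * schatten 1 (y * A1 α) := by
  have : sharpNorm α (kr x y) = schatten 1 (kron x y * kron (Amat α ν) (A1 α)) := rfl
  rw [this, kron_mul]
  exact schatten_kron _ _

lemma sharp_add (α : ℝ) {ν : ℕ} (x y : Matrix (Fin (2 ^ ν)) (Fin (2 ^ ν)) ℂ) :
    sharpNorm α (x + y) ≤ sharpNorm α x + sharpNorm α y := by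
  unfold sharpNorm
  rw [Matrix.add_mul]
  exact schatten_add _ _

lemma sharp_nonneg (α : ℝ) {ν : ℕ} (x : Matrix (Fin (2 ^ ν)) (Fin (2 ^ ν)) ℂ) :
    0 ≤ sharpNorm α x := schatten_nonneg _

lemma sharp_sum (α : ℝ) {ν : ℕ} {ι : Type*} (s : Finset ι)
    (x : ι → Matrix (Fin (2 ^ ν)) (Fin (2 ^ ν)) ℂ) :
    sharpNorm α (∑ i ∈ s, x i) ≤ ∑ i ∈ s, sharpNorm α (x i) := by
  classical
  induction s using Finset.induction_on with
  | empty => simp [sharpNorm, schatten_zero]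
  | insert i s hi ih =>
    rw [Finset.sum_insert hi, Finset.sum_insert hi]
    exact (sharp_add α _ _).trans (by linarith)

lemma sharp_coeff (α : ℝ) (r : ℕ → Matrix (Fin 2) (Fin 2) ℂ)
    (hr : ∀ j < 4, ∀ k < 4, rho1 α ((r j)ᴴ * r k) = if j = k then 1 else 0)
    (ν : ℕ) (x : ℕ → Matrix (Fin (2 ^ ν)) (Fin (2 ^ ν)) ℂ) (q : ℕ) (hq : q < 4)
    (c : ℝ) (hc : 0 ≤ c) (k : Matrix (Fin 2) (Fin 2) ℂ) (hk : IsContr k)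
    (hck : (r q)ᴴ = (c : ℂ) • k) :
    sharpNorm α (x q) ≤
      c * sharpNorm α (∑ p ∈ Finset.range 4, kr (x p) (r p)) := by
  set z : Matrix (Fin (2 ^ ν * 2)) (Fin (2 ^ ν * 2)) ℂ :=
    (∑ p ∈ Finset.range 4, kron (x p) (r p)) * kron (Amat α ν) (A1 α) with hz
  have h1 : sharpNorm α (∑ p ∈ Finset.range 4, kr (x p) (r p)) = schatten 1 z := rfl
  have h2 : x q * Amat α ν = ptr (kron 1 (r q)ᴴ * z) := by
    rw [hz, Matrix.sum_mul, Matrix.mul_sum, ptr_sum]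
    have : ∀ p ∈ Finset.range 4,
        ptr (kron 1 (r q)ᴴ * (kron (x p) (r p) * kron (Amat α ν) (A1 α))) =
        if q = p then x p * Amat α ν else 0 := by
      intro p hp
      rw [kron_mul, kron_mul, ptr_kron, ← Matrix.mul_assoc]
      have := hr q hq p (Finset.mem_range.1 hp)
      unfold rho1 at this
      rw [this]
      split_ifs <;> simp
    rw [Finset.sum_congr rfl this]
    simp [hq]
  have h3 : kron (1 : Matrix (Fin (2 ^ ν)) (Fin (2 ^ ν)) ℂ) (r q)ᴴ = (c : ℂ) • kron 1 k := by
    rw [hck]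
    ext i j
    obtain ⟨⟨i, k⟩, rfl⟩ := finProdFinEquiv.surjective i
    obtain ⟨⟨j, l⟩, rfl⟩ := finProdFinEquiv.surjective j
    simp only [Matrix.smul_apply, kron_apply, smul_eq_mul]
    ring
  rw [h1]
  unfold sharpNorm
  rw [h2]
  refine (schatten_ptr _).trans ?_
  rw [h3, Matrix.smul_mul]
  refine (schatten_smul _ _).trans ?_
  rw [Complex.norm_real, Real.norm_of_nonneg hc]
  exact mul_le_mul_of_nonneg_left (schatten_mul_left (isContr_one_kron hk) _) hc

lemma sharp_blk (α : ℝ) (r : ℕ → Matrix (Fin 2) (Fin 2) ℂ) (a : ℕ → ℂ) (ν q k : ℕ) (hq : q ≠ 0) :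
    sharpNorm α (blk r a ν q k) ≤ 2 * sharpNorm α (blk r a ν q (4 ^ ν)) := by
  have h4 : 4 ^ ν = 2 ^ ν * 2 ^ ν := by rw [← mul_pow]; norm_num
  obtain ⟨d, hd⟩ := Amat_diagonal α ν
  unfold sharpNorm blk
  rw [if_neg hq, if_neg hq, sum_eUnit_mask k, hd, mask_mul_diagonal]
  conv_rhs => rw [h4]
  rw [← h4]
  exact schatten_mask _ _

lemma schatten_r0 (α : ℝ) (hα0 : 0 < α) (hα : α ≤ 1 / 2) (u : Matrix (Fin 2) (Fin 2) ℂ)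
    (hu : IsContr u) : schatten 1 (u * A1 α) ≤ 1 := by
  have hp : (A1 α).PosSemidef := by
    unfold A1
    apply Matrix.PosSemidef.diagonal
    intro i
    fin_cases i
    · simpa using hα0.le
    · have : (0 : ℝ) ≤ 1 - α := by linarith
      have h2 : (0 : ℂ) ≤ ((1 - α : ℝ) : ℂ) := by exact_mod_cast this
      simpa using h2
  refine (schatten_contr_mul_psd hu hp).trans ?_
  simp [A1, Matrix.trace_diagonal, Fin.sum_univ_two]

/-- if `‖r_0‖ ≤ 1` then the left Haar systems are bases of `(N_ν, ‖·‖_♯)`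
with basis constants uniformly bounded in `ν`. -/
theorem haar_uniform_basis_constant_sharp
    (α : ℝ) (hα0 : 0 < α) (hα : α ≤ 1 / 2)
    (r : ℕ → Matrix (Fin 2) (Fin 2) ℂ)
    (hr : ∀ j < 4, ∀ k < 4, rho1 α ((r j)ᴴ * r k) = if j = k then 1 else 0)
    (hr0 : opNorm (r 0) ≤ 1) :
    ∃ C : ℝ, ∀ ν, 1 ≤ ν → ∀ m < 4 ^ ν, ∀ a : ℕ → ℂ,
      sharpNorm α (∑ j ∈ Finset.range (m + 1), a j • haar r ν j) ≤
        C * sharpNorm α (∑ j ∈ Finset.range (4 ^ ν), a j • haar r ν j) := by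
  choose c hc0 k hk hck using fun q : ℕ => exists_contr (r q)ᴴ
  set K : ℕ → ℝ := fun q => c q * schatten 1 (r q * A1 α) with hK
  have hK0 : ∀ q, 0 ≤ K q := fun q => mul_nonneg (hc0 q) (schatten_nonneg _)
  obtain ⟨C, hC⟩ : ∃ C : ℝ, C = 1 + 2 * ∑ q ∈ Finset.range 4, K q := ⟨_, rfl⟩
  have hC0 : 0 ≤ ∑ q ∈ Finset.range 4, K q := Finset.sum_nonneg fun q _ => hK0 q
  have hC1 : 1 ≤ C := by linarith
  have hCn : 0 ≤ C := by linarith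
  have main : ∀ ν m, m ≤ 4 ^ ν → ∀ a : ℕ → ℂ,
      sharpNorm α (hsum r a ν m) ≤ C * sharpNorm α (hsum r a ν (4 ^ ν)) := by
    intro ν
    induction ν with
    | zero =>
      intro m hm a
      have h1 : 0 ≤ sharpNorm α (hsum r a 0 (4 ^ 0)) := sharp_nonneg _ _
      have hm' : m = 0 ∨ m = 4 ^ 0 := by
        have h40 : 4 ^ 0 = 1 := pow_zero 4
        omega
      rcases hm' with rfl | rfl
      · have : sharpNorm α (hsum r a 0 0) = 0 := by
          simp [hsum, sharpNorm, schatten_zero]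
        rw [this]
        exact mul_nonneg hCn h1
      · exact le_mul_of_one_le_left h1 hC1
    | succ ν ih =>
      intro m hm a
      set S := sharpNorm α (hsum r a (ν + 1) (4 ^ (ν + 1))) with hS
      have hS0 : 0 ≤ S := sharp_nonneg _ _
      have hS' : S = sharpNorm α 
          (∑ p ∈ Finset.range 4, kr (blk r a ν p (4 ^ ν)) (r p)) := by
        rw [hS, hsum_full]
      have hx : ∀ q < 4, sharpNorm α (blk r a ν q (4 ^ ν)) ≤ c q * S := by
        intro q hq
        rw [hS']
        exact sharp_coeff α r hr ν (fun p => blk r a ν p (4 ^ ν)) q hq _ (hc0 q) _ (hk q) (hck q)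
      have hx0 : sharpNorm α (blk r a ν 0 (4 ^ ν)) ≤ S := by
        have h := sharp_coeff α r hr ν (fun p => blk r a ν p (4 ^ ν)) 0 (by norm_num) 1 zero_le_one
          (r 0)ᴴ (isContr_of_opNorm _ (by rw [opNorm_conjTranspose]; exact hr0)) (by simp)
        rw [one_mul] at h
        rw [hS']
        exact h
      have hKx : ∀ q < 4, sharpNorm α (kr (blk r a ν q (4 ^ ν)) (r q)) ≤ K q * S := by
        intro q hq
        refine (sharp_kr α ν _ _).trans ?_
        have := mul_le_mul_of_nonneg_right (hx q hq) (schatten_nonneg (r q * A1 α))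
        simp only [hK]
        linarith
      have h4 : 0 < 4 ^ ν := by positivity
      obtain ⟨q, l, hq, hl, rfl⟩ : ∃ q l, q < 4 ∧ l ≤ 4 ^ ν ∧ m = 4 ^ ν * q + l := by
        rcases hm.lt_or_eq with h | h
        · refine ⟨m / 4 ^ ν, m % 4 ^ ν, ?_, (Nat.mod_lt _ h4).le, (Nat.div_add_mod _ _).symm⟩
          rw [Nat.div_lt_iff_lt_mul h4]
          rw [pow_succ] at h
          linarith
        · exact ⟨3, 4 ^ ν, by norm_num, le_rfl, by rw [h]; ring⟩
      rcases eq_or_ne q 0 with h0 | h0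
      · subst h0
        have e : hsum r a (ν + 1) (4 ^ ν * 0 + l) =
            kr (blk r a ν 0 l) (r 0) := by
          rw [hsum_succ r a ν 0 l hq hl]; simp
        rw [e]
        refine (sharp_kr α ν _ _).trans ?_
        have h1 := schatten_r0 α hα0 hα (r 0) (isContr_of_opNorm _ hr0)
        have h2 : sharpNorm α (blk r a ν 0 l) ≤ C * sharpNorm α (blk r a ν 0 (4 ^ ν)) := by
          simpa [blk] using ih l hl a
        have h3 : 0 ≤ sharpNorm α (blk r a ν 0 l) := sharp_nonneg _ _
        calc _ ≤ sharpNorm α (blk r a ν 0 l) * 1 := mul_le_mul_of_nonneg_left h1 h3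
          _ ≤ C * sharpNorm α (blk r a ν 0 (4 ^ ν)) := by rw [mul_one]; exact h2
          _ ≤ C * S := mul_le_mul_of_nonneg_left hx0 hCn
      · have e : sharpNorm α (hsum r a (ν + 1) (4 ^ ν * q + l)) ≤
            ∑ p ∈ Finset.range q, K p * S + 2 * (K q * S) := by
          rw [hsum_succ r a ν q l hq hl]
          refine (sharp_add α _ _).trans (add_le_add ?_ ?_)
          · refine (sharp_sum α _ _).trans (Finset.sum_le_sum fun p hp => ?_)
            exact hKx p ((Finset.mem_range.1 hp).trans hq)
          · refine (sharp_kr α ν _ _).trans ?_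
            have h5 := (sharp_blk α r a ν q l h0).trans
              (mul_le_mul_of_nonneg_left (hx q hq) zero_le_two)
            have := mul_le_mul_of_nonneg_right h5 (schatten_nonneg (r q * A1 α))
            simp only [hK]
            linarith
        refine e.trans ?_
        have h6 : ∑ p ∈ Finset.range (q + 1), K p ≤ ∑ p ∈ Finset.range 4, K p :=
          Finset.sum_le_sum_of_subset_of_nonneg (Finset.range_mono hq) fun i _ _ => hK0 i
        rw [Finset.sum_range_succ] at h6
        have h7 : 0 ≤ ∑ p ∈ Finset.range q, K p := Finset.sum_nonneg fun p _ => hK0 p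
        rw [← Finset.sum_mul]
        calc _ = (∑ p ∈ Finset.range q, K p + 2 * K q) * S := by ring
          _ ≤ C * S := mul_le_mul_of_nonneg_right (by linarith) hS0
  exact ⟨C, fun ν _ m hm a => main ν (m + 1) hm a⟩

end
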